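/- For the (3,3,5) format, a generic complex 3×3×5 hypermatrix A is non-degenerate, yet its associated scheme 𝓝 ⊂ P^4 (defined by det N, where N is the 3×3 matrix of linear forms in z_1,…,z_5) always possesses bi-degenerate points: the subscheme 𝓝' defined by the 2×2 minors of N has codimension at most 4 in P^4, hence is nonempty. Thus the existence of a degenerate point in 𝓝 does not imply degeneracy of A. -/

import Mathlib

open Matrix

/-- The q×r matrix of linear forms in x associated to A, evaluated at x. -/
noncomputable def Lmat {p q r : ℕ} (A : Fin p → Fin q → Fin r → ℂ) (x : Fin p → ℂ) :
    Matrix (Fin q) (Fin r) ℂ := Matrix.of fun j k => ∑ i, A i j k * x i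

/-- The p×r matrix of linear forms in y associated to A, evaluated at y. -/
noncomputable def Mmat {p q r : ℕ} (A : Fin p → Fin q → Fin r → ℂ) (y : Fin q → ℂ) :
    Matrix (Fin p) (Fin r) ℂ := Matrix.of fun i k => ∑ j, A i j k * y j

/-- The p×q matrix of linear forms in z associated to A, evaluated at z. -/
noncomputable def Nmat {p q r : ℕ} (A : Fin p → Fin q → Fin r → ℂ) (z : Fin r → ℂ) :
    Matrix (Fin p) (Fin q) ℂ := Matrix.of fun i j => ∑ k, A i j k * z k

/-- A is degenerate if its kernel K_A is nonempty. -/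
def Degenerate {p q r : ℕ} (A : Fin p → Fin q → Fin r → ℂ) : Prop :=
  ∃ (P : Fin p → ℂ) (Q : Fin q → ℂ) (T : Fin r → ℂ),
    P ≠ 0 ∧ Q ≠ 0 ∧ T ≠ 0 ∧
    Matrix.vecMul Q (Lmat A P) = 0 ∧
    Matrix.vecMul P (Nmat A T) = 0 ∧
    (Mmat A Q).mulVec T = 0

namespace Segre335

/-- The polynomial ring in `x₀, x₁, x₂, y₀, y₁, y₂`. -/
abbrev R6 := MvPolynomial (Fin 3 ⊕ Fin 3) ℂ

/-- The parametrization of the Segre cone. -/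
noncomputable def par : MvPolynomial (Fin 3 × Fin 3) ℂ →ₐ[ℂ] R6 :=
  MvPolynomial.aeval fun ij => MvPolynomial.X (Sum.inl ij.1) * MvPolynomial.X (Sum.inr ij.2)

/-- The Segre ring. -/
noncomputable abbrev S : Subalgebra ℂ R6 := par.range

/-- The generator `x_i y_j`. -/
noncomputable def gen (i j : Fin 3) : S := par.rangeRestrict (MvPolynomial.X (i, j))

lemma gen_val (i j : Fin 3) :
    (gen i j : R6) = MvPolynomial.X (Sum.inl i) * MvPolynomial.X (Sum.inr j) := by
  change par (MvPolynomial.X (i, j)) = _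
  rw [par, MvPolynomial.aeval_X]

/-- Set the variables of `s` to zero. -/
noncomputable def sig (s : Finset (Fin 3 ⊕ Fin 3)) : R6 →ₐ[ℂ] R6 :=
  MvPolynomial.aeval fun v => if v ∈ s then 0 else MvPolynomial.X v

noncomputable def K (s : Finset (Fin 3 ⊕ Fin 3)) : Ideal S :=
  RingHom.ker ((sig s).comp S.val)

instance (s : Finset (Fin 3 ⊕ Fin 3)) : (K s).IsPrime := RingHom.ker_isPrime _

lemma mem_K (s : Finset (Fin 3 ⊕ Fin 3)) (p : S) : p ∈ K s ↔ sig s (p : R6) = 0 := Iff.rfl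

lemma gen_mem_K (s : Finset (Fin 3 ⊕ Fin 3)) (i j : Fin 3) :
    gen i j ∈ K s ↔ (Sum.inl i ∈ s ∨ Sum.inr j ∈ s) := by
  rw [mem_K, gen_val, map_mul, mul_eq_zero]
  simp only [sig, MvPolynomial.aeval_X]
  split_ifs <;> simp_all

lemma K_mono {s t : Finset (Fin 3 ⊕ Fin 3)} (h : s ⊆ t) : K s ≤ K t := by
  have e : (sig t).comp (sig s) = sig t := by
    apply MvPolynomial.algHom_ext
    intro v
    simp only [sig, AlgHom.comp_apply, MvPolynomial.aeval_X]
    by_cases hs : v ∈ s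
    · simp [hs, h hs]
    · simp [hs]
  intro p hp
  rw [mem_K] at *
  rw [← e, AlgHom.comp_apply, hp, map_zero]

lemma K_lt {s t : Finset (Fin 3 ⊕ Fin 3)} (h : s ⊆ t) (i j : Fin 3)
    (h1 : ¬ (Sum.inl i ∈ s ∨ Sum.inr j ∈ s)) (h2 : Sum.inl i ∈ t ∨ Sum.inr j ∈ t) :
    K s < K t := by
  refine lt_of_le_of_ne (K_mono h) fun e => h1 ?_
  rw [← gen_mem_K, e, gen_mem_K]
  exact h2

lemma height_ge : (5 : ℕ∞) ≤ (K Finset.univ).height := by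
  have h1 : K ∅ < K {Sum.inl 0} := K_lt (by decide) 0 0 (by decide) (by decide)
  have h2 : K {Sum.inl 0} < K {Sum.inl 0, Sum.inl 1} :=
    K_lt (by decide) 1 0 (by decide) (by decide)
  have h3 : K {Sum.inl 0, Sum.inl 1} < K {Sum.inl 0, Sum.inl 1, Sum.inr 0} :=
    K_lt (by decide) 2 0 (by decide) (by decide)
  have h4 : K {Sum.inl 0, Sum.inl 1, Sum.inr 0} <
      K {Sum.inl 0, Sum.inl 1, Sum.inr 0, Sum.inr 1} :=
    K_lt (by decide) 2 1 (by decide) (by decide)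
  have h5 : K {Sum.inl 0, Sum.inl 1, Sum.inr 0, Sum.inr 1} < K Finset.univ :=
    K_lt (by decide) 2 2 (by decide) (by decide)
  have g1 := Ideal.height_add_one_le_of_lt_of_isPrime h1
  have g2 := Ideal.height_add_one_le_of_lt_of_isPrime h2
  have g3 := Ideal.height_add_one_le_of_lt_of_isPrime h3
  have g4 := Ideal.height_add_one_le_of_lt_of_isPrime h4
  have g5 := Ideal.height_add_one_le_of_lt_of_isPrime h5
  calc (5 : ℕ∞) = 0 + 1 + 1 + 1 + 1 + 1 := by norm_num
    _ ≤ (K ∅).height + 1 + 1 + 1 + 1 + 1 := by gcongr; exact zero_le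
    _ ≤ _ := by
      refine le_trans ?_ g5
      gcongr
      refine le_trans ?_ g4
      gcongr
      refine le_trans ?_ g3
      gcongr
      exact le_trans (by gcongr) g2

lemma univ_le (q : Ideal S) (hq : ∀ i j, gen i j ∈ q) : K Finset.univ ≤ q := by
  have e1 : (Ideal.Quotient.mkₐ ℂ q).comp par.rangeRestrict =
      (Algebra.ofId ℂ (S ⧸ q)).comp (MvPolynomial.aeval fun _ => (0 : ℂ)) := by
    apply MvPolynomial.algHom_ext
    rintro ⟨i, j⟩
    rw [AlgHom.comp_apply, AlgHom.comp_apply, MvPolynomial.aeval_X, map_zero]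
    exact Ideal.Quotient.eq_zero_iff_mem.2 (hq i j)
  have e2 : ((sig Finset.univ).comp S.val).comp par.rangeRestrict =
      (Algebra.ofId ℂ R6).comp (MvPolynomial.aeval fun _ => (0 : ℂ)) := by
    apply MvPolynomial.algHom_ext
    rintro ⟨i, j⟩
    rw [AlgHom.comp_apply, AlgHom.comp_apply (Algebra.ofId ℂ R6), MvPolynomial.aeval_X, map_zero]
    exact (gen_mem_K Finset.univ i j).2 (by simp)
  intro p hp
  obtain ⟨f, rfl⟩ := par.rangeRestrict_surjective p
  have h2 := DFunLike.congr_fun e2 f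
  have hp' : ((sig Finset.univ).comp S.val).comp par.rangeRestrict f = 0 := hp
  rw [hp', AlgHom.comp_apply] at h2
  have h3 : MvPolynomial.aeval (fun _ => (0 : ℂ)) f = 0 :=
    (map_eq_zero_iff (Algebra.ofId ℂ R6) (algebraMap ℂ R6).injective |>.1 h2.symm)
  have h1 := DFunLike.congr_fun e1 f
  rw [AlgHom.comp_apply, AlgHom.comp_apply, h3, map_zero] at h1
  exact Ideal.Quotient.eq_zero_iff_mem.1 h1

instance : Algebra.FiniteType ℂ S :=
  Algebra.FiniteType.of_surjective par.rangeRestrict par.rangeRestrict_surjective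

instance : IsNoetherianRing S :=
  isNoetherianRing_of_surjective _ _ par.rangeRestrict.toRingHom par.rangeRestrict_surjective

instance : IsJacobsonRing S :=
  isJacobsonRing_of_surjective ⟨par.rangeRestrict.toRingHom, par.rangeRestrict_surjective⟩

/-- Four linear sections of the Segre cone have a common nonzero point. -/
lemma exists_point (f : Fin 4 → S) (hf : ∀ l, f l ∈ K Finset.univ) :
    ∃ φ : S →ₐ[ℂ] ℂ, (∀ l, φ (f l) = 0) ∧ ∃ i j, φ (gen i j) ≠ 0 := by
  have hle : Ideal.span (Set.range f) ≤ K Finset.univ := by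
    rw [Ideal.span_le]; rintro _ ⟨l, rfl⟩; exact hf l
  obtain ⟨q, hq, hqm⟩ := Ideal.exists_minimalPrimes_le hle
  have hqp : q.IsPrime := hq.1.1
  have hne : q ≠ K Finset.univ := by
    rintro rfl
    have h := Ideal.height_le_card_of_mem_minimalPrimes_span (Set.finite_range f) hq
    have h4 : (Set.range f).ncard ≤ 4 := by
      rw [← Set.image_univ]
      exact (Set.ncard_image_le).trans (by simp)
    have h5 := height_ge.trans (h.trans (Nat.cast_le.2 h4))
    exact absurd h5 (by decide)
  have : ∃ i j, gen i j ∉ q := by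
    by_contra! hcon
    exact hne (le_antisymm hqm (univ_le q hcon))
  obtain ⟨i, j, hij⟩ := this
  have hj : q.jacobson = q := isJacobsonRing_iff_prime_eq.1 inferInstance q hqp
  rw [← hj, Ideal.jacobson, Ideal.mem_sInf] at hij
  push Not at hij
  obtain ⟨n, ⟨hqn, hn⟩, hnij⟩ := hij
  let _ : Field (S ⧸ n) := Ideal.Quotient.field n
  have : Algebra.FiniteType ℂ (S ⧸ n) :=
    Algebra.FiniteType.of_surjective (Ideal.Quotient.mkₐ ℂ n) (Ideal.Quotient.mkₐ_surjective ℂ n)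
  have : Module.Finite ℂ (S ⧸ n) := finite_of_finite_type_of_isJacobsonRing ℂ (S ⧸ n)
  let e : ℂ ≃ₐ[ℂ] (S ⧸ n) := AlgEquiv.ofBijective (Algebra.ofId ℂ (S ⧸ n))
    (IsAlgClosed.algebraMap_bijective_of_isIntegral)
  refine ⟨(e.symm : (S ⧸ n) →ₐ[ℂ] ℂ).comp (Ideal.Quotient.mkₐ ℂ n), fun l => ?_, i, j, ?_⟩
  · have : Ideal.Quotient.mkₐ ℂ n (f l) = 0 :=
      Ideal.Quotient.eq_zero_iff_mem.2 (hqn (hq.1.2 (Ideal.subset_span ⟨l, rfl⟩)))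
    rw [AlgHom.comp_apply, this, map_zero]
  · intro h
    rw [AlgHom.comp_apply] at h
    have h' : e.symm (Ideal.Quotient.mkₐ ℂ n (gen i j)) = 0 := h
    rw [EmbeddingLike.map_eq_zero_iff] at h'
    exact hnij (Ideal.Quotient.eq_zero_iff_mem.1 h')

/-- `N` as a linear map. -/
noncomputable def Nlin (A : Fin 3 → Fin 3 → Fin 5 → ℂ) :
    (Fin 5 → ℂ) →ₗ[ℂ] Matrix (Fin 3) (Fin 3) ℂ where
  toFun := Nmat A
  map_add' x y := by
    ext i j
    simp [Nmat, mul_add, Finset.sum_add_distrib]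
  map_smul' c x := by
    ext i j
    simp only [Nmat, Matrix.of_apply, Pi.smul_apply, smul_eq_mul, Matrix.smul_apply,
      RingHom.id_apply, Finset.mul_sum]
    exact Finset.sum_congr rfl fun k _ => by ring

lemma bidegenerate (A : Fin 3 → Fin 3 → Fin 5 → ℂ) :
    ∃ T : Fin 5 → ℂ, T ≠ 0 ∧ (Nmat A T).rank ≤ 1 := by
  by_cases hinj : Function.Injective (Nlin A)
  swap
  · rw [injective_iff_map_eq_zero] at hinj
    push Not at hinj
    obtain ⟨T, hT, hT0⟩ := hinj
    refine ⟨T, hT0, ?_⟩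
    have : Nmat A T = 0 := hT
    rw [this]; simp
  let W := LinearMap.range (Nlin A)
  have hW : Module.finrank ℂ W = 5 := by
    rw [LinearMap.finrank_range_of_inj hinj]; simp
  have hQ : Module.finrank ℂ (Matrix (Fin 3) (Fin 3) ℂ ⧸ W) = 4 := by
    have := W.finrank_quotient_add_finrank
    rw [hW, Module.finrank_matrix] at this
    simp at this
    omega
  let e : (Matrix (Fin 3) (Fin 3) ℂ ⧸ W) ≃ₗ[ℂ] (Fin 4 → ℂ) :=
    LinearEquiv.ofFinrankEq _ _ (by rw [hQ]; simp)
  let g : Matrix (Fin 3) (Fin 3) ℂ →ₗ[ℂ] (Fin 4 → ℂ) := e.toLinearMap ∘ₗ W.mkQ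
  have hg : ∀ w, g w = 0 → w ∈ W := fun w hw => by
    have : e (W.mkQ w) = 0 := hw
    rw [LinearEquiv.map_eq_zero_iff] at this
    exact (Submodule.Quotient.mk_eq_zero W).1 this
  let f : Fin 4 → S := fun l => ∑ i, ∑ j, g (Matrix.single i j 1) l • gen i j
  obtain ⟨φ, hφ, a, b, hab⟩ := exists_point f (fun l => by
    refine Ideal.sum_mem _ fun i _ => Ideal.sum_mem _ fun j _ => ?_
    rw [Algebra.smul_def]
    exact Ideal.mul_mem_left _ _ ((gen_mem_K _ _ _).2 (by simp)))
  let w : Matrix (Fin 3) (Fin 3) ℂ := Matrix.of fun i j => φ (gen i j)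
  have hw : g w = 0 := by
    ext l
    have h := hφ l
    simp only [f, map_sum, map_smul] at h
    rw [Matrix.matrix_eq_sum_single w]
    simp only [map_sum, Finset.sum_apply, Pi.zero_apply]
    rw [← h]
    refine Finset.sum_congr rfl fun i _ => Finset.sum_congr rfl fun j _ => ?_
    have : Matrix.single i j (w i j) = w i j • Matrix.single i j (1 : ℂ) := by simp
    rw [this, map_smul, Pi.smul_apply, smul_eq_mul, smul_eq_mul, mul_comm]
    rfl
  obtain ⟨T, hT⟩ := hg w hw
  refine ⟨T, ?_, ?_⟩
  · rintro rfl
    rw [map_zero] at hT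
    exact hab (congrFun (congrFun hT.symm a) b)
  · have hT' : Nmat A T = w := hT
    have hv : w = Matrix.vecMulVec (fun i => φ (gen i b)) (fun j => φ (gen a j) / φ (gen a b)) := by
      ext i j
      rw [Matrix.vecMulVec_apply, mul_div_assoc', eq_div_iff hab, ← map_mul]
      change φ (gen i j) * φ (gen a b) = _
      rw [← map_mul]
      congr 1
      apply Subtype.ext
      simp only [MulMemClass.coe_mul, gen_val]
      ring
    rw [hT', hv]
    exact Matrix.rank_vecMulVec_le _ _

lemma nondegenerate :
    ¬ Degenerate (fun (i j : Fin 3) (k : Fin 5) => if i.1 + j.1 = k.1 then (1 : ℂ) else 0) := by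
  rintro ⟨P, Q, T, hP, hQ, -, h, -, -⟩
  have h0 := congrFun h 0
  have h1 := congrFun h 1
  have h2 := congrFun h 2
  have h3 := congrFun h 3
  have h4 := congrFun h 4
  simp [Matrix.vecMul, dotProduct, Lmat, Fin.sum_univ_three] at h0 h1 h2 h3 h4
  apply hP
  have hQ' : ¬ (Q 0 = 0 ∧ Q 1 = 0 ∧ Q 2 = 0) := by
    rintro ⟨a, b, c⟩
    apply hQ
    ext i; fin_cases i <;> assumption
  ext i
  fin_cases i <;> simp <;> grind

end Segre335

/-- there is a non-degenerate (indeed the generic) 3×3×5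
hypermatrix, yet for every 3×3×5 hypermatrix the scheme 𝓝 ⊂ P⁴ has a
bi-degenerate point, i.e. a nonzero T with rank N(T) ≤ 1. Thus a degenerate
point of 𝓝 does not imply degeneracy of A. -/
theorem format_3_3_5 :
    (∃ A : Fin 3 → Fin 3 → Fin 5 → ℂ, ¬ Degenerate A) ∧
    (∀ A : Fin 3 → Fin 3 → Fin 5 → ℂ,
      ∃ T : Fin 5 → ℂ, T ≠ 0 ∧ (Nmat A T).rank ≤ 1) :=
  ⟨⟨_, Segre335.nondegenerate⟩, Segre335.bidegenerate⟩
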